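/- Define the polynomial g(x,y) = 331776*x^6 - 42192*x^2 + 48400*y^2 - 448512*y^3 - 84480*x^2*y + 589824*y^4 + 28032*y - 25344*x^4 + 1138176*x^2*y^2 - 884736*x^2*y^3 - 1105920*x^4*y - 5329 + 331776*x^4*y^2. Then the point (0, 73/192) is the unique real point (x,y) with g(x,y) = 0, ∂g/∂x(x,y) = 0 and ∂g/∂y(x,y) = 0. That is, g(0, 73/192) = 0, both partial derivatives of g vanish at (0, 73/192), and any real (x,y) satisfying all three equations equals (0, 73/192). -/

import Mathlib

/-- The polynomial defining the parallel lines at offset r = 1/4 to the parabola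
4*(1/3)*y = x^2. -/
noncomputable def g12 (x y : ℝ) : ℝ :=
  331776*x^6 - 42192*x^2 + 48400*y^2 - 448512*y^3 - 84480*x^2*y + 589824*y^4 + 28032*y -
    25344*x^4 + 1138176*x^2*y^2 - 884736*x^2*y^3 - 1105920*x^4*y - 5329 + 331776*x^4*y^2

lemma g12_deriv_x (x y : ℝ) : deriv (fun t : ℝ => g12 t y) x =
    331776*(6*x^5) - 42192*(2*x) - 84480*(2*x)*y - 25344*(4*x^3) + 1138176*(2*x)*y^2
      - 884736*(2*x)*y^3 - 1105920*(4*x^3)*y + 331776*(4*x^3)*y^2 := by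
  have e : (fun t : ℝ => g12 t y) = fun t : ℝ => 331776*t^6
      + (331776*y^2 - 1105920*y - 25344)*t^4
      + (1138176*y^2 - 884736*y^3 - 84480*y - 42192)*t^2
      + (48400*y^2 - 448512*y^3 + 589824*y^4 + 28032*y - 5329) := by
    funext t; unfold g12; ring
  rw [e]
  have h := ((((hasDerivAt_pow 6 x).const_mul 331776).add
    ((hasDerivAt_pow 4 x).const_mul (331776*y^2 - 1105920*y - 25344))).add
    ((hasDerivAt_pow 2 x).const_mul
      (1138176*y^2 - 884736*y^3 - 84480*y - 42192))).add_const
    (48400*y^2 - 448512*y^3 + 589824*y^4 + 28032*y - 5329)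
  refine Eq.trans h.deriv ?_
  norm_num
  ring

lemma g12_deriv_y (x y : ℝ) : deriv (fun t : ℝ => g12 x t) y =
    48400*(2*y) - 448512*(3*y^2) - 84480*x^2 + 589824*(4*y^3) + 28032
      + 1138176*x^2*(2*y) - 884736*x^2*(3*y^2) - 1105920*x^4 + 331776*x^4*(2*y) := by
  have e : (fun t : ℝ => g12 x t) = fun t : ℝ => 589824*t^4
      + (-448512 - 884736*x^2)*t^3
      + (48400 + 1138176*x^2 + 331776*x^4)*t^2
      + (28032 - 84480*x^2 - 1105920*x^4)*t^1
      + (331776*x^6 - 42192*x^2 - 25344*x^4 - 5329) := by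
    funext t; unfold g12; ring
  rw [e]
  have h := (((((hasDerivAt_pow 4 y).const_mul 589824).add
    ((hasDerivAt_pow 3 y).const_mul (-448512 - 884736*x^2))).add
    ((hasDerivAt_pow 2 y).const_mul (48400 + 1138176*x^2 + 331776*x^4))).add
    ((hasDerivAt_pow 1 y).const_mul (28032 - 84480*x^2 - 1105920*x^4))).add_const
    (331776*x^6 - 42192*x^2 - 25344*x^4 - 5329)
  refine Eq.trans h.deriv ?_
  norm_num
  ring

theorem parabola_subcritical_unique_singular_point :
    g12 0 (73/192) = 0 ∧
    deriv (fun t : ℝ => g12 t (73/192)) 0 = 0 ∧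
    deriv (fun t : ℝ => g12 0 t) (73/192) = 0 ∧
    ∀ x y : ℝ, g12 x y = 0 →
      deriv (fun t : ℝ => g12 t y) x = 0 →
      deriv (fun t : ℝ => g12 x t) y = 0 →
      (x, y) = ((0 : ℝ), (73/192 : ℝ)) := by
  refine ⟨by norm_num [g12], by rw [g12_deriv_x]; norm_num, by rw [g12_deriv_y]; norm_num, ?_⟩
  intro x y h1 h2 h3
  rw [g12_deriv_x] at h2
  rw [g12_deriv_y] at h3
  unfold g12 at h1
  by_cases hx : x = 0
  · subst hx
    have h4 : (192*y-73)^2*((4*y-1)*(4*y+1)) = 0 := by linear_combination h1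
    rcases mul_eq_zero.1 h4 with h | h
    · have h5 : 192*y-73 = 0 := pow_eq_zero_iff (two_ne_zero) |>.1 h
      have : y = 73/192 := by linarith
      rw [this]
    · exfalso
      rcases mul_eq_zero.1 h with h | h
      · have : y = 1/4 := by linarith
        subst this; norm_num at h3
      · have : y = -1/4 := by linarith
        subst this; norm_num at h3
  · exfalso
    -- the invariants I, J of the quartic in the foot-point parameter
    obtain ⟨I, hI⟩ : ∃ I : ℝ, I = 27/4*x^2 + 9*y^2 - 3*y + 37/64 := ⟨_, rfl⟩
    obtain ⟨J, hJ⟩ : ∃ J : ℝ, J = (2-3*y)*(81/4*(x^2+y^2-1/16) - (1-3/2*y)^2) - 243/4*x^2 :=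
      ⟨_, rfl⟩
    obtain ⟨m, hm⟩ : ∃ m : ℝ, m = -1-3*y := ⟨_, rfl⟩
    have hIpos : 0 < I := by rw [hI]; nlinarith [sq_nonneg x, sq_nonneg (y-1/6)]
    have e1 : 4*I^3 = J^2 := by
      rw [hI, hJ]; linear_combination (19683/5308416) * h1
    have e2 : 2*I^2 = J*m := by
      have : x*(2*I^2 - J*m) = 0 := by
        rw [hI, hJ, hm]; linear_combination (19683/5308416/81) * h2
      rcases mul_eq_zero.1 this with h | h
      · exact absurd h hx
      · linarith
    have e3 : I = m^2 := by
      have : I^3*(I - m^2) = 0 := by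
        linear_combination (1/4)*(2*I^2+J*m)*e2 - (1/4)*m^2*e1
      rcases mul_eq_zero.1 this with h | h
      · exact absurd h (by positivity)
      · linarith
    have hm0 : m ≠ 0 := by
      rintro rfl
      norm_num at e3
      linarith
    have e4 : J = 2*m^3 := by
      have : m*(J - 2*m^3) = 0 := by rw [e3] at e2; linear_combination -e2
      rcases mul_eq_zero.1 this with h | h
      · exact absurd h hm0
      · linarith
    have e5 : x^2 = 4/3*y + 1/16 := by
      rw [hI, hm] at e3; linear_combination (4/27)*e3
    rw [hJ, hm, e5] at e4
    ring_nf at e4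
    linarith
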